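/- arXiv:1106.6050 — 4 statements merged into one kernel-verified Lean document; each statement's English description precedes it below -/
import Mathlib

section
/- There exist infinitely many twin primes (i.e., infinitely many primes p such that p + 2 is also prime) if and only if there does NOT exist a positive integer N such that every positive integer n ≥ N can be written in at least one of the forms n = 6xy + x − y, n = 6xy + x + y, or n = 6xy − x − y for some positive integers x and y. -/
/-- Two factors of a number prime to `6` are both of the form `6 * x + 1` or `6 * x + 5`, and
their residues determine that of the product. -/
theorem exists_residues_of_mul {a b k r : ℕ} (h : a * b = 6 * k + r) (hr : r = 1 ∨ r = 5) :
    ∃ x y s t, a = 6 * x + s ∧ b = 6 * y + t ∧ (s = 1 ∨ s = 5) ∧ (t = 1 ∨ t = 5) ∧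
      (r = 1 ↔ s = t) := by
  refine ⟨a / 6, b / 6, a % 6, b % 6, by omega, by omega, ?_⟩
  have hm : a % 6 * (b % 6) % 6 = r := by
    rw [← Nat.mul_mod, h]; omega
  have ha : a % 6 < 6 := Nat.mod_lt _ (by norm_num)
  have hb : b % 6 < 6 := Nat.mod_lt _ (by norm_num)
  generalize a % 6 = s at *
  generalize b % 6 = t at *
  interval_cases s <;> interval_cases t <;> omega

theorem representable_iff_not_twin_prime {p n : ℕ} (hn : 0 < n) (hp : p + 1 = 6 * n) :
    (∃ x y : ℕ, 0 < x ∧ 0 < y ∧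
      (n = 6 * x * y + x - y ∨ n = 6 * x * y + x + y ∨ n = 6 * x * y - x - y)) ↔
    ¬ (p.Prime ∧ (p + 2).Prime) := by
  constructor
  · rintro ⟨x, y, hx, hy, h⟩ ⟨h₁, h₂⟩
    obtain ⟨u, rfl⟩ : ∃ u, x = u + 1 := ⟨x - 1, by omega⟩
    obtain ⟨v, rfl⟩ : ∃ v, y = v + 1 := ⟨y - 1, by omega⟩
    have e : 6 * (u + 1) * (v + 1) = 6 * (u * v) + 6 * u + 6 * v + 6 := by ring
    rw [e] at h
    rcases h with h | h | h
    · refine Nat.not_prime_mul (a := 6 * u + 5) (b := 6 * v + 7) (by omega) (by omega) ?_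
      convert h₁ using 1
      ring_nf at *
      omega
    · refine Nat.not_prime_mul (a := 6 * u + 7) (b := 6 * v + 7) (by omega) (by omega) ?_
      convert h₂ using 1
      ring_nf at *
      omega
    · refine Nat.not_prime_mul (a := 6 * u + 5) (b := 6 * v + 5) (by omega) (by omega) ?_
      convert h₂ using 1
      ring_nf at *
      omega
  · intro h
    rw [not_and_or] at h
    rcases h with h | h
    · obtain ⟨a, b, ha, hb, hab⟩ := (Nat.not_prime_iff_exists_mul_eq (by omega)).1 h
      have ha1 : a ≠ 1 := by rintro rfl; omega
      have hb1 : b ≠ 1 := by rintro rfl; omega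
      obtain ⟨x, y, s, t, rfl, rfl, hs, ht, hst⟩ :=
        exists_residues_of_mul (k := n - 1) (r := 5) (a := a) (b := b) (by omega) (.inr rfl)
      have e : 6 * (x + 1) * y = 6 * (x * y) + 6 * y := by ring
      have e' : 6 * (y + 1) * x = 6 * (x * y) + 6 * x := by ring
      rcases hs with rfl | rfl <;> rcases ht with rfl | rfl
      · omega
      · refine ⟨y + 1, x, by omega, by omega, .inl ?_⟩
        rw [e']; ring_nf at hab ⊢; omega
      · refine ⟨x + 1, y, by omega, by omega, .inl ?_⟩
        rw [e]; ring_nf at hab ⊢; omega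
      · omega
    · obtain ⟨a, b, ha, hb, hab⟩ := (Nat.not_prime_iff_exists_mul_eq (by omega)).1 h
      have ha1 : a ≠ 1 := by rintro rfl; omega
      have hb1 : b ≠ 1 := by rintro rfl; omega
      obtain ⟨x, y, s, t, rfl, rfl, hs, ht, hst⟩ :=
        exists_residues_of_mul (k := n) (r := 1) (a := a) (b := b) (by omega) (.inl rfl)
      have e : 6 * (x + 1) * (y + 1) = 6 * (x * y) + 6 * x + 6 * y + 6 := by ring
      rcases hs with rfl | rfl <;> rcases ht with rfl | rfl
      · refine ⟨x, y, by omega, by omega, .inr (.inl ?_)⟩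
        rw [mul_assoc]; ring_nf at hab ⊢; omega
      · omega
      · omega
      · refine ⟨x + 1, y + 1, by omega, by omega, .inr (.inr ?_)⟩
        rw [e]; ring_nf at hab ⊢; omega

theorem six_dvd_succ_of_twin_prime {p : ℕ} (hp : 3 < p) (h₁ : p.Prime) (h₂ : (p + 2).Prime) :
    6 ∣ p + 1 := by
  have a := (Nat.prime_dvd_prime_iff_eq Nat.prime_two h₁).not.2 (by omega)
  have b := (Nat.prime_dvd_prime_iff_eq Nat.prime_three h₁).not.2 (by omega)
  have c := (Nat.prime_dvd_prime_iff_eq Nat.prime_three h₂).not.2 (by omega)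
  have hlt : p % 6 < 6 := Nat.mod_lt _ (by norm_num)
  generalize hr : p % 6 = r at hlt
  interval_cases r <;> omega

theorem twin_prime_iff_no_threshold :
    {p : ℕ | p.Prime ∧ (p + 2).Prime}.Infinite ↔
    ¬ ∃ N : ℕ, 0 < N ∧ ∀ n : ℕ, N ≤ n →
      ∃ x y : ℕ, 0 < x ∧ 0 < y ∧
        (n = 6 * x * y + x - y ∨ n = 6 * x * y + x + y ∨ n = 6 * x * y - x - y) := by
  constructor
  · rintro hinf ⟨N, hN, h⟩
    obtain ⟨p, ⟨h₁, h₂⟩, hp⟩ := hinf.exists_gt (6 * N)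
    obtain ⟨n, hn⟩ := six_dvd_succ_of_twin_prime (by omega) h₁ h₂
    exact (representable_iff_not_twin_prime (by omega) hn).1 (h n (by omega)) ⟨h₁, h₂⟩
  · intro h
    refine Set.infinite_of_forall_exists_gt fun M => ?_
    by_contra hM
    refine h ⟨M + 1, by omega, fun n hn => ?_⟩
    refine (representable_iff_not_twin_prime (p := 6 * n - 1) (by omega) (by omega)).2 fun hp => ?_
    exact hM ⟨6 * n - 1, hp, by omega⟩
end

section
/- For every positive integer n, the number 6n − 1 is not prime if and only if there exist positive integers x and y such that n = 6xy + x − y. -/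
theorem exists_of_mul_eq_six_mul_sub_one {n a b : ℕ} (hb : 1 < b) (ha6 : a % 6 = 5)
    (hb6 : b % 6 = 1) (h : a * b + 1 = 6 * n) :
    ∃ x y : ℕ, 0 < x ∧ 0 < y ∧ n = 6 * x * y + x - y := by
  obtain ⟨k, rfl⟩ : ∃ k, a = 6 * k + 5 := ⟨a / 6, by omega⟩
  obtain ⟨y, rfl⟩ : ∃ y, b = 6 * y + 1 := ⟨b / 6, by omega⟩
  refine ⟨k + 1, y, by omega, by omega, ?_⟩
  have hn : n + y = 6 * (k + 1) * y + (k + 1) := by linarith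
  omega

theorem mod_six_of_mul_mod_six_eq_five {a b : ℕ} (h : a * b % 6 = 5) :
    a % 6 = 5 ∧ b % 6 = 1 ∨ a % 6 = 1 ∧ b % 6 = 5 := by
  rw [Nat.mul_mod] at h
  have ha := Nat.mod_lt a (show 0 < 6 by norm_num)
  have hb := Nat.mod_lt b (show 0 < 6 by norm_num)
  generalize a % 6 = r at *
  generalize b % 6 = s at *
  interval_cases r <;> interval_cases s <;> simp_all

theorem six_n_sub_one_not_prime_iff (n : ℕ) (hn : 0 < n) :
    ¬ (6 * n - 1).Prime ↔
    ∃ x y : ℕ, 0 < x ∧ 0 < y ∧ n = 6 * x * y + x - y := by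
  constructor
  · intro h
    obtain ⟨a, b, ha, hb, hab⟩ := (Nat.not_prime_iff_exists_mul_eq (by omega)).1 h
    have ha1 : a ≠ 1 := by rintro rfl; omega
    have hb1 : b ≠ 1 := by rintro rfl; omega
    rcases mod_six_of_mul_mod_six_eq_five (a := a) (b := b) (by omega) with
      ⟨ha6, hb6⟩ | ⟨ha6, hb6⟩
    · exact exists_of_mul_eq_six_mul_sub_one (by omega) ha6 hb6 (by omega)
    · exact exists_of_mul_eq_six_mul_sub_one (by omega) hb6 ha6 (by rw [mul_comm]; omega)
  · rintro ⟨x, y, hx, hy, h⟩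
    obtain ⟨k, rfl⟩ : ∃ k, x = k + 1 := ⟨x - 1, by omega⟩
    have hsum : n + y = 6 * (k + 1) * y + (k + 1) := by omega
    have hfactor : 6 * n - 1 = (6 * k + 5) * (6 * y + 1) := by
      have : 6 * n = (6 * k + 5) * (6 * y + 1) + 1 := by linarith
      omega
    rw [hfactor]
    exact Nat.not_prime_mul (by omega) (by omega)
end

section
/- For every positive integer n, the number 6n + 1 is not prime if and only if there exist positive integers x and y such that n = 6xy + x + y or n = 6xy − x − y. -/
theorem six_n_add_one_not_prime_iff (n : ℕ) (hn : 0 < n) :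
    ¬ (6 * n + 1).Prime ↔
    ∃ x y : ℕ, 0 < x ∧ 0 < y ∧
      (n = 6 * x * y + x + y ∨ n = 6 * x * y - x - y) := by
  constructor
  · intro h
    obtain ⟨a, b, ha, hb, hab⟩ := (Nat.not_prime_iff_exists_mul_eq (by omega)).1 h
    have ha1 : a ≠ 1 := by rintro rfl; omega
    have hb1 : b ≠ 1 := by rintro rfl; omega
    have hmod : a % 6 * (b % 6) % 6 = 1 := by
      rw [← Nat.mul_mod, hab]; omega
    have hres : a % 6 = 1 ∧ b % 6 = 1 ∨ a % 6 = 5 ∧ b % 6 = 5 := by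
      have h1 := Nat.mod_lt a (show 6 > 0 by norm_num)
      have h2 := Nat.mod_lt b (show 6 > 0 by norm_num)
      generalize a % 6 = r at *
      generalize b % 6 = s at *
      interval_cases r <;> interval_cases s <;> simp_all
    rcases hres with ⟨hr, hs⟩ | ⟨hr, hs⟩
    · obtain ⟨x, rfl⟩ : ∃ x, a = 6 * x + 1 := ⟨a / 6, by omega⟩
      obtain ⟨y, rfl⟩ : ∃ y, b = 6 * y + 1 := ⟨b / 6, by omega⟩
      exact ⟨x, y, by omega, by omega, Or.inl (by linarith)⟩
    · obtain ⟨x, rfl⟩ : ∃ x, a = 6 * x + 5 := ⟨a / 6, by omega⟩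
      obtain ⟨y, rfl⟩ : ∃ y, b = 6 * y + 5 := ⟨b / 6, by omega⟩
      refine ⟨x + 1, y + 1, by omega, by omega, Or.inr ?_⟩
      ring_nf at hab ⊢
      omega
  · rintro ⟨x, y, hx, hy, h | h⟩
    · have key : 6 * n + 1 = (6 * x + 1) * (6 * y + 1) := by rw [h]; ring
      rw [key]
      exact Nat.not_prime_mul (by omega) (by omega)
    · obtain ⟨x, rfl⟩ := Nat.exists_eq_add_of_le' hx
      obtain ⟨y, rfl⟩ := Nat.exists_eq_add_of_le' hy
      have key : 6 * n + 1 = (6 * x + 5) * (6 * y + 5) := by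
        ring_nf at h ⊢
        omega
      rw [key]
      exact Nat.not_prime_mul (by omega) (by omega)
end

section
/- For every positive integer n, both 6n − 1 and 6n + 1 are prime (i.e., (6n − 1, 6n + 1) is a twin prime pair) if and only if for all positive integers x and y one has n ≠ 6xy + x − y, n ≠ 6xy + x + y, and n ≠ 6xy − x − y. -/
theorem Nat.exists_eq_mul_of_not_prime {m : ℕ} (hm : 2 ≤ m) (h : ¬ m.Prime) :
    ∃ a b : ℕ, 1 < a ∧ 1 < b ∧ m = a * b := by
  obtain ⟨a, b, ha, hb, hab⟩ := (Nat.not_prime_iff_exists_mul_eq hm).1 h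
  refine ⟨a, b, ?_, ?_, hab.symm⟩ <;> by_contra! hle
  · interval_cases a <;> omega
  · interval_cases b <;> omega

theorem Nat.mod_six_of_mul_mod_six {a b : ℕ} (h : a * b % 6 = 1 ∨ a * b % 6 = 5) :
    a * b % 6 = 1 ∧ (a % 6 = 1 ∧ b % 6 = 1 ∨ a % 6 = 5 ∧ b % 6 = 5) ∨
      a * b % 6 = 5 ∧ (a % 6 = 1 ∧ b % 6 = 5 ∨ a % 6 = 5 ∧ b % 6 = 1) := by
  have ha : a % 6 < 6 := Nat.mod_lt _ (by norm_num)
  have hb : b % 6 < 6 := Nat.mod_lt _ (by norm_num)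
  rw [Nat.mul_mod] at h ⊢
  generalize a % 6 = r at *
  generalize b % 6 = s at *
  interval_cases r <;> interval_cases s <;> simp_all

theorem Nat.exists_eq_six_mul_add_one {a : ℕ} (ha : 1 < a) (h : a % 6 = 1) :
    ∃ x, 0 < x ∧ a = 6 * x + 1 :=
  ⟨a / 6, by omega, by omega⟩

theorem Nat.exists_add_one_eq_six_mul {a : ℕ} (h : a % 6 = 5) :
    ∃ x, 0 < x ∧ a + 1 = 6 * x :=
  ⟨a / 6 + 1, by omega, by omega⟩

theorem Nat.prime_six_mul_sub_one_iff {n : ℕ} (hn : 0 < n) :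
    (6 * n - 1).Prime ↔ ∀ x y : ℕ, 0 < x → 0 < y → n ≠ 6 * x * y + x - y := by
  constructor
  · rintro hp x y hx hy rfl
    have hfac : 6 * (6 * x * y + x - y) - 1 = (6 * x - 1) * (6 * y + 1) := by
      have : y ≤ 6 * x * y := Nat.le_mul_of_pos_left y (by omega)
      zify [show y ≤ 6 * x * y + x by omega,
        show 1 ≤ 6 * (6 * x * y + x - y) by omega, show 1 ≤ 6 * x by omega]
      ring
    rw [hfac] at hp
    exact Nat.not_prime_mul (by omega) (by omega) hp
  · intro h
    by_contra hp
    obtain ⟨a, b, ha, hb, hab⟩ := Nat.exists_eq_mul_of_not_prime (by omega) hp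
    have key : ∀ a b : ℕ, 1 < b → 6 * n - 1 = a * b → a % 6 = 5 → b % 6 = 1 → False := by
      intro a b hb hab ha5 hb1
      obtain ⟨x, hx, hax⟩ := Nat.exists_add_one_eq_six_mul ha5
      obtain ⟨y, hy, rfl⟩ := Nat.exists_eq_six_mul_add_one hb hb1
      refine h x y hx hy (Nat.eq_sub_of_add_eq ?_)
      zify [show 1 ≤ 6 * n by omega] at hab hax ⊢
      rw [show (a : ℤ) = 6 * x - 1 by linarith] at hab
      linarith
    rcases Nat.mod_six_of_mul_mod_six (a := a) (b := b) (by omega) with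
      ⟨h1, -⟩ | ⟨-, ⟨ha1, hb5⟩ | ⟨ha5, hb1⟩⟩
    · omega
    · exact key b a ha (by rw [hab, mul_comm]) hb5 ha1
    · exact key a b hb hab ha5 hb1

theorem Nat.prime_six_mul_add_one_iff {n : ℕ} (hn : 0 < n) :
    (6 * n + 1).Prime ↔ ∀ x y : ℕ, 0 < x → 0 < y →
      n ≠ 6 * x * y + x + y ∧ n ≠ 6 * x * y - x - y := by
  have le (x y : ℕ) (hx : 0 < x) (hy : 0 < y) : x + y ≤ 6 * x * y := by
    nlinarith [Nat.mul_le_mul hx hy, Nat.mul_le_mul_left x hy, Nat.mul_le_mul_right y hx]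
  constructor
  · rintro hp x y hx hy
    refine ⟨?_, ?_⟩ <;> rintro rfl
    · rw [show 6 * (6 * x * y + x + y) + 1 = (6 * x + 1) * (6 * y + 1) by ring] at hp
      exact Nat.not_prime_mul (by omega) (by omega) hp
    · have hfac : 6 * (6 * x * y - x - y) + 1 = (6 * x - 1) * (6 * y - 1) := by
        have := le x y hx hy
        rw [Nat.sub_sub]
        zify [this, show 1 ≤ 6 * x by omega, show 1 ≤ 6 * y by omega]
        ring
      rw [hfac] at hp
      exact Nat.not_prime_mul (by omega) (by omega) hp
  · intro h
    by_contra hp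
    obtain ⟨a, b, ha, hb, hab⟩ := Nat.exists_eq_mul_of_not_prime (by omega) hp
    rcases Nat.mod_six_of_mul_mod_six (a := a) (b := b) (by omega) with
      ⟨-, ⟨ha1, hb1⟩ | ⟨ha5, hb5⟩⟩ | ⟨h5, -⟩
    · obtain ⟨x, hx, rfl⟩ := Nat.exists_eq_six_mul_add_one ha ha1
      obtain ⟨y, hy, rfl⟩ := Nat.exists_eq_six_mul_add_one hb hb1
      exact (h x y hx hy).1 (by linarith)
    · obtain ⟨x, hx, hax⟩ := Nat.exists_add_one_eq_six_mul ha5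
      obtain ⟨y, hy, hby⟩ := Nat.exists_add_one_eq_six_mul hb5
      refine (h x y hx hy).2 ?_
      rw [Nat.sub_sub]
      refine Nat.eq_sub_of_add_eq ?_
      zify at hab hax hby ⊢
      rw [show (a : ℤ) = 6 * x - 1 by linarith, show (b : ℤ) = 6 * y - 1 by linarith] at hab
      linarith
    · omega

theorem twin_prime_pair_iff (n : ℕ) (hn : 0 < n) :
    ((6 * n - 1).Prime ∧ (6 * n + 1).Prime) ↔
    ∀ x y : ℕ, 0 < x → 0 < y →
      n ≠ 6 * x * y + x - y ∧ n ≠ 6 * x * y + x + y ∧ n ≠ 6 * x * y - x - y := by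
  rw [Nat.prime_six_mul_sub_one_iff hn, Nat.prime_six_mul_add_one_iff hn]
  exact ⟨fun h x y hx hy => ⟨h.1 x y hx hy, h.2 x y hx hy⟩,
    fun h => ⟨fun x y hx hy => (h x y hx hy).1, fun x y hx hy => (h x y hx hy).2⟩⟩
end
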